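/- arXiv:1805.09081 — 5 statements merged into one kernel-verified Lean document; each statement's English description precedes it below -/
import Mathlib

section
/- Theorem 2 (Distance on the locally disconnected graph controls the entries of H). Let N be a positive integer, S ⊆ Fin N with complement S', and A an N×N real matrix that is symmetric, has nonnegative entries, and satisfies ‖A‖_∞ ≤ ρ for a fixed 0 < ρ < 1. Set B := A² and H := (I_{S'} − B_{S'})⁻¹. Let G_{S↛S} denote the simple graph on Fin N in which distinct vertices u, v are adjacent if and only if A_{uv} > 0 and not both u and v belong to S (i.e., the support graph of A with all edges inside S removed). Then for any two distinct nodes ℓ, m ∈ S' that are joined by a walk in G_{S↛S}, if the graph distance of ℓ and m in G_{S↛S} equals r, then the (ℓ,m) entry of H satisfies H_{ℓm} ≤ ρ^r / (1 − ρ²). -/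
/-!
Theorem 2 (Distance on the locally disconnected graph controls the entries of `H`).
-/

open scoped Classical

noncomputable section

section helper
attribute [local instance] Matrix.linftyOpNormedAddCommGroup Matrix.linftyOpNormedRing
  Matrix.linftyOpNormedSpace Matrix.linftyOpNormedAlgebra

lemma aux_entry_le {n : Type} [Fintype n] [DecidableEq n] (M : Matrix n n ℝ) (i j : n) :
    M i j ≤ ‖M‖ := by
  rw [Matrix.linfty_opNorm_def]
  have h1 : ‖M i j‖₊ ≤ ∑ j, ‖M i j‖₊ :=
    Finset.single_le_sum (f := fun j => ‖M i j‖₊) (fun _ _ => zero_le) (Finset.mem_univ j)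
  have h2 : (∑ j, ‖M i j‖₊) ≤ Finset.univ.sup fun i => ∑ j, ‖M i j‖₊ :=
    Finset.le_sup (f := fun i => ∑ j, ‖M i j‖₊) (Finset.mem_univ i)
  have h3 : ‖M i j‖ ≤ ((Finset.univ.sup fun i => ∑ j, ‖M i j‖₊ : NNReal) : ℝ) := by
    exact_mod_cast h1.trans h2
  exact (le_abs_self _).trans h3

lemma aux_norm_le {n : Type} [Fintype n] [DecidableEq n] (M : Matrix n n ℝ) (c : ℝ)
    (hc : 0 ≤ c) (h : ∀ i, ∑ j, |M i j| ≤ c) : ‖M‖ ≤ c := by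
  rw [Matrix.linfty_opNorm_def]
  lift c to NNReal using hc
  rw [NNReal.coe_le_coe]
  refine Finset.sup_le fun i _ => ?_
  rw [← NNReal.coe_le_coe]
  push_cast
  exact h i

lemma aux_inv {n : Type} [Fintype n] [DecidableEq n] (B : Matrix n n ℝ) (c : ℝ)
    (hc : 0 ≤ c) (hc1 : c < 1) (h : ∀ i, ∑ j, |B i j| ≤ c) (K : ℕ) (i j : n)
    (hz : ∀ k < K, (B ^ k) i j = 0) : (1 - B)⁻¹ i j ≤ c ^ K / (1 - c) := by
  have hB := aux_norm_le B c hc h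
  haveI : Nonempty n := ⟨i⟩
  have hu : IsUnit (1 - B) := isUnit_one_sub_of_norm_lt_one (hB.trans_lt hc1)
  have hdet := (Matrix.isUnit_iff_isUnit_det _).1 hu
  set H := (1 - B)⁻¹ with hH
  have h1 : (1 - B) * H = 1 := Matrix.mul_nonsing_inv _ hdet
  have h2 : H = 1 + B * H := by
    rw [sub_mul, one_mul] at h1
    rw [← h1]; abel
  have hone : ‖(1 : Matrix n n ℝ)‖ ≤ 1 := by
    apply aux_norm_le _ _ zero_le_one
    intro i
    simp [Matrix.one_apply, apply_ite abs]
  have h3 : ‖H‖ ≤ 1 + c * ‖H‖ := by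
    calc ‖H‖ = ‖1 + B * H‖ := by rw [← h2]
      _ ≤ ‖(1 : Matrix n n ℝ)‖ + ‖B * H‖ := norm_add_le _ _
      _ ≤ 1 + c * ‖H‖ := add_le_add hone ((norm_mul_le _ _).trans (by gcongr))
  have h4 : ‖H‖ ≤ 1 / (1 - c) := by
    rw [le_div_iff₀ (by linarith)]; linarith
  have h5 : ∀ K : ℕ, H = ∑ k ∈ Finset.range K, B ^ k + B ^ K * H := by
    intro K
    induction K with
    | zero => simp
    | succ K ih =>
      rw [Finset.sum_range_succ, pow_succ, add_assoc, mul_assoc]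
      nth_rewrite 1 [ih]
      nth_rewrite 1 [h2]
      rw [mul_add, mul_one]
  have h6 : H i j = (B ^ K * H) i j := by
    nth_rewrite 1 [h5 K]
    rw [Matrix.add_apply, Matrix.sum_apply, Finset.sum_eq_zero, zero_add]
    intro k hk
    exact hz k (Finset.mem_range.1 hk)
  have h7 : ‖B ^ K‖ ≤ c ^ K := by
    rcases Nat.eq_zero_or_pos K with rfl | hK
    · simpa using hone
    · exact (norm_pow_le' B hK).trans (by gcongr)
  rw [h6]
  calc (B ^ K * H) i j ≤ ‖B ^ K * H‖ := aux_entry_le _ _ _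
    _ ≤ ‖B ^ K‖ * ‖H‖ := norm_mul_le _ _
    _ ≤ c ^ K * (1 / (1 - c)) := by gcongr
    _ = c ^ K / (1 - c) := by ring
end helper

lemma aux_walk {V : Type} [Fintype V] (G : SimpleGraph V)
    {n : Type} [Fintype n] [DecidableEq n] (f : n → V) (B : Matrix n n ℝ)
    (hB : ∀ i j, B i j ≠ 0 → ∃ p : G.Walk (f i) (f j), p.length ≤ 2) (k : ℕ) :
    ∀ i j, (B ^ k) i j ≠ 0 → ∃ p : G.Walk (f i) (f j), p.length ≤ 2 * k := by
  induction k with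
  | zero =>
    intro i j h
    have : i = j := by
      by_contra hne
      exact h (by simp [Matrix.one_apply, hne])
    subst this
    exact ⟨.nil, by simp⟩
  | succ k ih =>
    intro i j h
    rw [pow_succ, Matrix.mul_apply] at h
    obtain ⟨l, -, hl⟩ := Finset.exists_ne_zero_of_sum_ne_zero h
    obtain ⟨p, hp⟩ := ih i l (left_ne_zero_of_mul hl)
    obtain ⟨q, hq⟩ := hB l j (right_ne_zero_of_mul hl)
    exact ⟨p.append q, by rw [SimpleGraph.Walk.length_append]; omega⟩

/-- **Theorem 2**: let `A` be symmetric, nonnegative, with maximum absolute row sum at most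
`ρ < 1`, let `B = A²`, `H = (I_{S'} − B_{S'})⁻¹`, and let `G_{S↛S}` be the support graph of
`A` with all edges inside `S` removed.  If two distinct nodes `ℓ, m ∈ S'` are joined by a
walk in `G_{S↛S}` and their graph distance there equals `r`, then
`H_{ℓm} ≤ ρ^r / (1 − ρ²)`. -/
theorem distance_controls_H
    (N : ℕ) (S : Finset (Fin N)) (ρ : ℝ) (hρ0 : 0 < ρ) (hρ1 : ρ < 1)
    (A : Matrix (Fin N) (Fin N) ℝ) (hsymm : A.IsSymm)
    (hpos : ∀ u v, 0 ≤ A u v)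
    (hnorm : ∀ u : Fin N, ∑ v, |A u v| ≤ ρ)
    (ℓ m : Fin N) (hℓ : ℓ ∉ S) (hm : m ∉ S) (hlm : ℓ ≠ m) (r : ℕ)
    (hreach : (SimpleGraph.fromRel
        fun u v : Fin N => 0 < A u v ∧ ¬(u ∈ S ∧ v ∈ S)).Reachable ℓ m)
    (hdist : (SimpleGraph.fromRel
        fun u v : Fin N => 0 < A u v ∧ ¬(u ∈ S ∧ v ∈ S)).dist ℓ m = r) :
    ((1 - (A ^ 2).submatrix (Subtype.val : {x : Fin N // x ∉ S} → Fin N) Subtype.val)⁻¹)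
        (⟨ℓ, hℓ⟩ : {x : Fin N // x ∉ S}) (⟨m, hm⟩ : {x : Fin N // x ∉ S}) ≤ ρ ^ r / (1 - ρ ^ 2) := by
  set G := SimpleGraph.fromRel fun u v : Fin N => 0 < A u v ∧ ¬(u ∈ S ∧ v ∈ S) with hG
  have hstep : ∀ u v, A u v ≠ 0 → ¬(u ∈ S ∧ v ∈ S) → ∃ p : G.Walk u v, p.length ≤ 1 := by
    intro u v h1 h2
    by_cases huv : u = v
    · subst huv
      exact ⟨.nil, by simp⟩
    · have hadj : G.Adj u v := by
        rw [hG, SimpleGraph.fromRel_adj]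
        exact ⟨huv, Or.inl ⟨lt_of_le_of_ne (hpos u v) (Ne.symm h1), h2⟩⟩
      exact ⟨hadj.toWalk, by simp⟩
  have hrow : ∀ u, ∑ v, A u v ≤ ρ := by
    intro u
    simpa [abs_of_nonneg (hpos _ _)] using hnorm u
  have hB0 : ∀ u v, 0 ≤ (A ^ 2) u v := by
    intro u v
    rw [pow_two, Matrix.mul_apply]
    exact Finset.sum_nonneg fun w _ => mul_nonneg (hpos _ _) (hpos _ _)
  have hBrow : ∀ u, ∑ v, (A ^ 2) u v ≤ ρ ^ 2 := by
    intro u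
    calc ∑ v, (A ^ 2) u v = ∑ w, A u w * ∑ v, A w v := by
          simp only [pow_two, Matrix.mul_apply, Finset.mul_sum]
          exact Finset.sum_comm
      _ ≤ ∑ w, A u w * ρ :=
          Finset.sum_le_sum fun w _ => mul_le_mul_of_nonneg_left (hrow w) (hpos u w)
      _ = (∑ w, A u w) * ρ := by rw [Finset.sum_mul]
      _ ≤ ρ * ρ := mul_le_mul_of_nonneg_right (hrow u) hρ0.le
      _ = ρ ^ 2 := by ring
  have hρ2 : ρ ^ 2 < 1 := by nlinarith
  refine (aux_inv _ (ρ ^ 2) (by positivity) hρ2 ?_ ((r + 1) / 2) _ _ ?_).trans ?_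
  · intro i
    simp only [Matrix.submatrix_apply, abs_of_nonneg (hB0 _ _)]
    refine le_trans ?_ (hBrow i.1)
    rw [← Finset.sum_image (f := fun v => (A ^ 2) i.1 v) (s := Finset.univ)
      (g := (Subtype.val : {x : Fin N // x ∉ S} → Fin N)) (Subtype.val_injective.injOn)]
    exact Finset.sum_le_sum_of_subset_of_nonneg (Finset.subset_univ _) fun v _ _ => hB0 _ _
  · intro k hk
    by_contra hne
    obtain ⟨p, hp⟩ := aux_walk G (Subtype.val : {x : Fin N // x ∉ S} → Fin N) _ (by
      intro i j hij
      rw [Matrix.submatrix_apply, pow_two, Matrix.mul_apply] at hij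
      obtain ⟨w, -, hw⟩ := Finset.exists_ne_zero_of_sum_ne_zero hij
      obtain ⟨p, hp⟩ := hstep i.1 w (left_ne_zero_of_mul hw) (fun h => i.2 h.1)
      obtain ⟨q, hq⟩ := hstep w j.1 (right_ne_zero_of_mul hw) (fun h => j.2 h.2)
      exact ⟨p.append q, by rw [SimpleGraph.Walk.length_append]; omega⟩) k _ _ hne
    have := SimpleGraph.dist_le p
    simp only [hdist] at this
    omega
  · rw [← pow_mul]
    have h1 : ρ ^ (2 * ((r + 1) / 2)) ≤ ρ ^ r :=
      pow_le_pow_of_le_one hρ0.le hρ1.le (by omega)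
    exact div_le_div_of_nonneg_right h1 (by linarith)

end
end

section
/- Error-matrix representation. Let N be a positive integer, S ⊆ Fin N with complement S', and A an N×N real matrix that is symmetric, has nonnegative entries, and satisfies ‖A‖_∞ ≤ ρ for a fixed 0 < ρ < 1. Set B := A², R₀ := (I − A²)⁻¹, R₁ := A R₀ and H := (I_{S'} − B_{S'})⁻¹. Then the principal submatrix [R₀]_S is invertible, and the error matrix E_S := [R₁]_S ([R₀]_S)⁻¹ − A_S admits the representation E_S = A_{SS'} · H · B_{S'S}. -/
/-!
Error-matrix representation: `E_S = A_{SS'} H B_{S'S}`.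
-/

open scoped Classical

noncomputable section

lemma sub_mul_split {N : ℕ} (S : Finset (Fin N)) {m n : Type*} (X Y : Matrix (Fin N) (Fin N) ℝ)
    (f : m → Fin N) (g : n → Fin N) :
    (X * Y).submatrix f g =
      X.submatrix f (Subtype.val : {x : Fin N // x ∈ S} → Fin N) *
        Y.submatrix (Subtype.val : {x : Fin N // x ∈ S} → Fin N) g +
      X.submatrix f (Subtype.val : {x : Fin N // x ∉ S} → Fin N) *
        Y.submatrix (Subtype.val : {x : Fin N // x ∉ S} → Fin N) g := by
  ext i j
  simp only [Matrix.submatrix_apply, Matrix.mul_apply, Matrix.add_apply]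
  convert (Fintype.sum_subtype_add_sum_subtype (fun x => x ∈ S) (fun k => X (f i) k * Y k (g j))).symm

lemma isUnit_one_sub {n : Type*} [Fintype n] [DecidableEq n] (B : Matrix n n ℝ)
    (h : ∀ i, ∑ j, |B i j| < 1) : IsUnit (1 - B) := by
  rw [Matrix.isUnit_iff_isUnit_det, isUnit_iff_ne_zero]
  apply det_ne_zero_of_sum_row_lt_diag
  intro i
  have h1 := h i
  rw [← Finset.add_sum_erase _ _ (Finset.mem_univ i)] at h1
  have h2 : ∑ j ∈ Finset.univ.erase i, ‖(1 - B) i j‖ = ∑ j ∈ Finset.univ.erase i, |B i j| := by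
    apply Finset.sum_congr rfl
    intro j hj
    have : i ≠ j := (Finset.ne_of_mem_erase hj).symm
    simp [Matrix.one_apply_ne this]
  rw [h2]
  have h3 : 1 - |B i i| ≤ ‖(1 - B) i i‖ := by
    simp only [Matrix.sub_apply, Matrix.one_apply_eq, Real.norm_eq_abs]
    have := le_abs_self (B i i)
    have := le_abs_self (1 - B i i)
    linarith
  linarith

lemma row_sum_sq {N : ℕ} (ρ : ℝ) (hρ0 : 0 < ρ) (hρ1 : ρ < 1)
    (A : Matrix (Fin N) (Fin N) ℝ) (hnorm : ∀ u : Fin N, ∑ v, |A u v| ≤ ρ) (u : Fin N) :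
    ∑ v, |(A ^ 2) u v| < 1 := by
  calc ∑ v, |(A ^ 2) u v| ≤ ∑ v, ∑ w, |A u w| * |A w v| := by
        apply Finset.sum_le_sum
        intro v _
        rw [pow_two, Matrix.mul_apply]
        refine (Finset.abs_sum_le_sum_abs _ _).trans (le_of_eq ?_)
        simp only [abs_mul]
    _ = ∑ w, |A u w| * ∑ v, |A w v| := by
        rw [Finset.sum_comm]; simp only [Finset.mul_sum]
    _ ≤ ∑ w, |A u w| * ρ := by
        apply Finset.sum_le_sum
        intro w _
        exact mul_le_mul_of_nonneg_left (hnorm w) (abs_nonneg _)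
    _ = (∑ w, |A u w|) * ρ := by rw [Finset.sum_mul]
    _ ≤ ρ * ρ := mul_le_mul_of_nonneg_right (hnorm u) hρ0.le
    _ < 1 := by nlinarith

/-- **Error-matrix representation**: for a symmetric nonnegative matrix `A` with maximum
absolute row sum at most `ρ < 1`, setting `B = A²`, `R₀ = (I − A²)⁻¹`, `R₁ = A R₀` and
`H = (I_{S'} − B_{S'})⁻¹`, the principal submatrix `[R₀]_S` is invertible and the error
matrix `E_S = [R₁]_S ([R₀]_S)⁻¹ − A_S` equals `A_{SS'} · H · B_{S'S}`. -/
theorem error_matrix_representation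
    (N : ℕ) (S : Finset (Fin N)) (ρ : ℝ) (hρ0 : 0 < ρ) (hρ1 : ρ < 1)
    (A : Matrix (Fin N) (Fin N) ℝ) (hsymm : A.IsSymm)
    (hpos : ∀ u v, 0 ≤ A u v)
    (hnorm : ∀ u : Fin N, ∑ v, |A u v| ≤ ρ) :
    IsUnit (((1 - A ^ 2)⁻¹).submatrix
        (Subtype.val : {x : Fin N // x ∈ S} → Fin N)
        (Subtype.val : {x : Fin N // x ∈ S} → Fin N)) ∧
    ((A * (1 - A ^ 2)⁻¹).submatrix
          (Subtype.val : {x : Fin N // x ∈ S} → Fin N)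
          (Subtype.val : {x : Fin N // x ∈ S} → Fin N) *
        (((1 - A ^ 2)⁻¹).submatrix
          (Subtype.val : {x : Fin N // x ∈ S} → Fin N)
          (Subtype.val : {x : Fin N // x ∈ S} → Fin N))⁻¹ -
        A.submatrix
          (Subtype.val : {x : Fin N // x ∈ S} → Fin N)
          (Subtype.val : {x : Fin N // x ∈ S} → Fin N)) =
      A.submatrix
          (Subtype.val : {x : Fin N // x ∈ S} → Fin N)
          (Subtype.val : {x : Fin N // x ∉ S} → Fin N) *
        (1 - (A ^ 2).submatrix
          (Subtype.val : {x : Fin N // x ∉ S} → Fin N)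
          (Subtype.val : {x : Fin N // x ∉ S} → Fin N))⁻¹ *
        (A ^ 2).submatrix
          (Subtype.val : {x : Fin N // x ∉ S} → Fin N)
          (Subtype.val : {x : Fin N // x ∈ S} → Fin N) := by
  have hB := row_sum_sq ρ hρ0 hρ1 A hnorm
  have hM : IsUnit (1 - A ^ 2) := isUnit_one_sub _ hB
  have hK : IsUnit (1 - (A ^ 2).submatrix
      (Subtype.val : {x : Fin N // x ∉ S} → Fin N)
      (Subtype.val : {x : Fin N // x ∉ S} → Fin N)) := by
    apply isUnit_one_sub
    intro i
    refine lt_of_le_of_lt ?_ (hB i)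
    rw [← Fintype.sum_subtype_add_sum_subtype (fun x => x ∈ S) (fun v => |(A ^ 2) i v|)]
    exact le_add_of_nonneg_left (Finset.sum_nonneg fun _ _ => abs_nonneg _)
  have hMR : (1 - A ^ 2) * (1 - A ^ 2)⁻¹ = 1 :=
    Matrix.mul_nonsing_inv _ ((Matrix.isUnit_iff_isUnit_det _).1 hM)
  have hKH := Matrix.nonsing_inv_mul _ ((Matrix.isUnit_iff_isUnit_det _).1 hK)
  have e1 := sub_mul_split S (1 - A ^ 2) (1 - A ^ 2)⁻¹
    (Subtype.val : {x : Fin N // x ∉ S} → Fin N) (Subtype.val : {x : Fin N // x ∈ S} → Fin N)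
  have e2 := sub_mul_split S (1 - A ^ 2) (1 - A ^ 2)⁻¹
    (Subtype.val : {x : Fin N // x ∈ S} → Fin N) (Subtype.val : {x : Fin N // x ∈ S} → Fin N)
  have e3 := sub_mul_split S A (1 - A ^ 2)⁻¹
    (Subtype.val : {x : Fin N // x ∈ S} → Fin N) (Subtype.val : {x : Fin N // x ∈ S} → Fin N)
  have o1 : (1 : Matrix (Fin N) (Fin N) ℝ).submatrix
      (Subtype.val : {x : Fin N // x ∉ S} → Fin N)
      (Subtype.val : {x : Fin N // x ∈ S} → Fin N) = 0 := by
    ext i j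
    have : (i : Fin N) ≠ j := fun h => i.2 (h ▸ j.2)
    simp [Matrix.one_apply_ne this]
  have o2 : (1 - A ^ 2).submatrix
      (Subtype.val : {x : Fin N // x ∉ S} → Fin N)
      (Subtype.val : {x : Fin N // x ∈ S} → Fin N) = - (A ^ 2).submatrix
      (Subtype.val : {x : Fin N // x ∉ S} → Fin N)
      (Subtype.val : {x : Fin N // x ∈ S} → Fin N) := by
    rw [Matrix.submatrix_sub, Pi.sub_apply, Pi.sub_apply, o1, zero_sub]
  have o3 : (1 - A ^ 2).submatrix
      (Subtype.val : {x : Fin N // x ∉ S} → Fin N)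
      (Subtype.val : {x : Fin N // x ∉ S} → Fin N) = 1 - (A ^ 2).submatrix
      (Subtype.val : {x : Fin N // x ∉ S} → Fin N)
      (Subtype.val : {x : Fin N // x ∉ S} → Fin N) := by
    rw [Matrix.submatrix_sub, Pi.sub_apply, Pi.sub_apply,
      Matrix.submatrix_one _ Subtype.val_injective]
  rw [hMR, o1, o2, o3] at e1
  rw [hMR, Matrix.submatrix_one _ Subtype.val_injective] at e2
  generalize (1 - (A ^ 2).submatrix
      (Subtype.val : {x : Fin N // x ∉ S} → Fin N)
      (Subtype.val : {x : Fin N // x ∉ S} → Fin N))⁻¹ = H at *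
  rw [e3]
  generalize (1 - A ^ 2)⁻¹.submatrix (Subtype.val : {x : Fin N // x ∈ S} → Fin N)
    (Subtype.val : {x : Fin N // x ∈ S} → Fin N) = R at *
  generalize (1 - A ^ 2)⁻¹.submatrix (Subtype.val : {x : Fin N // x ∉ S} → Fin N)
    (Subtype.val : {x : Fin N // x ∈ S} → Fin N) = Q at *
  have hQ : Q = H * (A ^ 2).submatrix (Subtype.val : {x : Fin N // x ∉ S} → Fin N)
      (Subtype.val : {x : Fin N // x ∈ S} → Fin N) * R := by
    rw [Matrix.neg_mul, eq_comm, neg_add_eq_zero] at e1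
    rw [Matrix.mul_assoc, e1, ← Matrix.mul_assoc, hKH, Matrix.one_mul]
  subst hQ
  have hR : IsUnit R := by
    rw [← Matrix.mul_assoc, ← Matrix.add_mul] at e2
    exact (Matrix.isUnit_iff_isUnit_det _).2 (Matrix.isUnit_det_of_left_inverse e2.symm)
  refine ⟨hR, ?_⟩
  have hRR := Matrix.mul_nonsing_inv _ ((Matrix.isUnit_iff_isUnit_det _).1 hR)
  rw [← Matrix.mul_assoc, ← Matrix.add_mul, Matrix.mul_assoc _ R, hRR, Matrix.mul_one,
    add_sub_cancel_left, Matrix.mul_assoc]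

end
end

section
/- Nonnegativity of the error matrix. Let N be a positive integer, S ⊆ Fin N with complement S', and A an N×N real matrix that is symmetric, has nonnegative entries, and satisfies ‖A‖_∞ ≤ ρ for a fixed 0 < ρ < 1. Set R₀ := (I − A²)⁻¹ and R₁ := A R₀. Then every entry of the error matrix E_S := [R₁]_S ([R₀]_S)⁻¹ − A_S is nonnegative. -/
/-!
Nonnegativity of the error matrix `E_S = [R₁]_S ([R₀]_S)⁻¹ − A_S`.
-/

open scoped Classical

noncomputable section

theorem aux_min {n : Type*} [Fintype n] (B : Matrix n n ℝ) (r : ℝ) (hr1 : r < 1)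
    (hB : ∀ i j, 0 ≤ B i j) (hrow : ∀ i, ∑ j, B i j ≤ r) (w : n → ℝ)
    (hw : ∀ i, 0 ≤ w i ∨ w i = ∑ j, B i j * w j) : ∀ i, 0 ≤ w i := by
  intro i0
  have : Nonempty n := ⟨i0⟩
  obtain ⟨m, hm⟩ := Finite.exists_min w
  refine le_trans ?_ (hm i0)
  by_contra hneg
  push Not at hneg
  rcases hw m with h | h
  · linarith
  · have h1 : ∑ j, B m j * w m ≤ ∑ j, B m j * w j :=
      Finset.sum_le_sum fun j _ => mul_le_mul_of_nonneg_left (hm j) (hB m j)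
    rw [← Finset.sum_mul, ← h] at h1
    nlinarith [hrow m]

theorem aux_zero {n : Type*} [Fintype n] (B : Matrix n n ℝ) (r : ℝ) (hr1 : r < 1)
    (hB : ∀ i j, 0 ≤ B i j) (hrow : ∀ i, ∑ j, B i j ≤ r) (w : n → ℝ)
    (hw : ∀ i, w i = 0 ∨ w i = ∑ j, B i j * w j) : w = 0 := by
  funext i
  have h1 := aux_min B r hr1 hB hrow w (fun i => (hw i).imp (fun h => h.ge) id) i
  have h2 := aux_min B r hr1 hB hrow (-w) (fun i => (hw i).imp
    (fun h => by simp [h]) (fun h => by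
      simp only [Pi.neg_apply, mul_neg, Finset.sum_neg_distrib]; rw [← h])) i
  simp only [Pi.neg_apply] at h2
  simp only [Pi.zero_apply]
  linarith

theorem aux_apply {n : Type*} [Fintype n] [DecidableEq n] (B : Matrix n n ℝ) (w : n → ℝ) (i : n) :
    (1 - B).mulVec w i = w i - ∑ j, B i j * w j := by
  rw [Matrix.sub_mulVec, Matrix.one_mulVec]; rfl

theorem aux_inv_s9 {n : Type*} [Fintype n] [DecidableEq n] (M : Matrix n n ℝ)
    (h : ∀ v, M.mulVec v = 0 → v = 0) : M * M⁻¹ = 1 := by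
  apply Matrix.mul_nonsing_inv
  rw [isUnit_iff_ne_zero]
  intro hd
  obtain ⟨v, hv, hv0⟩ := Matrix.exists_mulVec_eq_zero_iff.mpr hd
  exact hv (h v hv0)

/-- **Nonnegativity of the error matrix**: for a symmetric nonnegative matrix `A` with
maximum absolute row sum at most `ρ < 1`, setting `R₀ = (I − A²)⁻¹` and `R₁ = A R₀`, every
entry of `E_S = [R₁]_S ([R₀]_S)⁻¹ − A_S` is nonnegative. -/
theorem error_matrix_nonneg
    (N : ℕ) (S : Finset (Fin N)) (ρ : ℝ) (hρ0 : 0 < ρ) (hρ1 : ρ < 1)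
    (A : Matrix (Fin N) (Fin N) ℝ) (hsymm : A.IsSymm)
    (hpos : ∀ u v, 0 ≤ A u v)
    (hnorm : ∀ u : Fin N, ∑ v, |A u v| ≤ ρ) :
    ∀ a b : {x : Fin N // x ∈ S},
      0 ≤ ((A * (1 - A ^ 2)⁻¹).submatrix
            (Subtype.val : {x : Fin N // x ∈ S} → Fin N)
            (Subtype.val : {x : Fin N // x ∈ S} → Fin N) *
          (((1 - A ^ 2)⁻¹).submatrix
            (Subtype.val : {x : Fin N // x ∈ S} → Fin N)
            (Subtype.val : {x : Fin N // x ∈ S} → Fin N))⁻¹ -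
          A.submatrix
            (Subtype.val : {x : Fin N // x ∈ S} → Fin N)
            (Subtype.val : {x : Fin N // x ∈ S} → Fin N)) a b := by
  intro a b
  have hrowA : ∀ u, ∑ v, A u v ≤ ρ := fun u => by
    simpa [abs_of_nonneg (hpos u _)] using hnorm u
  obtain ⟨B, hBdef⟩ : ∃ B, B = A ^ 2 := ⟨_, rfl⟩
  rw [← hBdef]
  have hB : ∀ i j, 0 ≤ B i j := fun i j => by
    rw [hBdef, pow_two, Matrix.mul_apply]
    exact Finset.sum_nonneg fun k _ => mul_nonneg (hpos _ _) (hpos _ _)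
  have hrow : ∀ i, ∑ j, B i j ≤ ρ := fun i => by
    simp only [hBdef, pow_two, Matrix.mul_apply]
    rw [Finset.sum_comm]
    simp only [← Finset.mul_sum]
    refine le_trans (Finset.sum_le_sum fun k _ => ?_) (hrowA i)
    exact mul_le_of_le_one_right (hpos i k) ((hrowA k).trans hρ1.le)
  have hMR : (1 - B) * (1 - B)⁻¹ = 1 := by
    apply aux_inv_s9
    intro v hv
    refine aux_zero B ρ hρ1 hB hrow v fun i => Or.inr ?_
    have := congrFun hv i
    rw [aux_apply, Pi.zero_apply] at this
    linarith
  generalize (1 - B)⁻¹ = R at hMR ⊢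
  -- the column potential generated by `x` on `S`
  have key : ∀ x : {x : Fin N // x ∈ S} → ℝ, ∀ i, i ∉ S →
      (∑ s, R i s.1 * x s) = ∑ j, B i j * ∑ s, R j s.1 * x s := by
    intro x i hi
    have h2 : (1 - B).mulVec (fun j => ∑ s : {x : Fin N // x ∈ S}, R j s.1 * x s) i
        = ∑ s : {x : Fin N // x ∈ S}, ((1 - B) * R) i s.1 * x s := by
      simp only [Matrix.mulVec, dotProduct, Matrix.mul_apply, Finset.mul_sum, Finset.sum_mul]
      rw [Finset.sum_comm]
      simp only [mul_assoc]
    rw [hMR, aux_apply] at h2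
    have h3 : ∑ s : {x : Fin N // x ∈ S}, (1 : Matrix (Fin N) (Fin N) ℝ) i s.1 * x s = 0 := by
      refine Finset.sum_eq_zero fun s _ => ?_
      rw [Matrix.one_apply_ne (fun h : i = s.1 => hi (h.symm ▸ s.2)), zero_mul]
    rw [h3] at h2
    linarith
  have hRS : R.submatrix (Subtype.val : {x : Fin N // x ∈ S} → Fin N)
      (Subtype.val : {x : Fin N // x ∈ S} → Fin N) *
      (R.submatrix (Subtype.val : {x : Fin N // x ∈ S} → Fin N)
      (Subtype.val : {x : Fin N // x ∈ S} → Fin N))⁻¹ = 1 := by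
    apply aux_inv_s9
    intro x hx
    have hz : (fun i => ∑ s, R i s.1 * x s) = 0 := by
      refine aux_zero B ρ hρ1 hB hrow _ fun i => ?_
      by_cases hi : i ∈ S
      · exact Or.inl (congrFun hx ⟨i, hi⟩)
      · exact Or.inr (key x i hi)
    funext t
    have h2 : (1 - B).mulVec (fun j => ∑ s : {x : Fin N // x ∈ S}, R j s.1 * x s) t.1
        = ∑ s : {x : Fin N // x ∈ S}, ((1 - B) * R) t.1 s.1 * x s := by
      simp only [Matrix.mulVec, dotProduct, Matrix.mul_apply, Finset.mul_sum, Finset.sum_mul]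
      rw [Finset.sum_comm]
      simp only [mul_assoc]
    rw [hz, hMR, Matrix.mulVec_zero] at h2
    simp only [Matrix.one_apply, Pi.zero_apply, Subtype.val_inj, ite_mul, one_mul, zero_mul,
      Finset.sum_ite_eq, Finset.mem_univ, if_true] at h2
    exact h2.symm
  generalize (R.submatrix (Subtype.val : {x : Fin N // x ∈ S} → Fin N)
      (Subtype.val : {x : Fin N // x ∈ S} → Fin N))⁻¹ = Q
    at hRS ⊢
  have hS : ∀ t : {x : Fin N // x ∈ S}, ∑ s, R t.1 s.1 * Q s b =
      (1 : Matrix {x : Fin N // x ∈ S} {x : Fin N // x ∈ S} ℝ) t b := by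
    intro t
    rw [← hRS]; rfl
  have hw : ∀ i, 0 ≤ ∑ s : {x : Fin N // x ∈ S}, R i s.1 * Q s b := by
    refine aux_min B ρ hρ1 hB hrow _ fun i => ?_
    by_cases hi : i ∈ S
    · left
      rw [hS ⟨i, hi⟩, Matrix.one_apply]
      split_ifs <;> norm_num
    · exact Or.inr (key (fun s => Q s b) i hi)
  have hE : ((A * R).submatrix (Subtype.val : {x : Fin N // x ∈ S} → Fin N)
      (Subtype.val : {x : Fin N // x ∈ S} → Fin N) * Q) a b =
      ∑ j, A a.1 j * ∑ s : {x : Fin N // x ∈ S}, R j s.1 * Q s b := by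
    simp only [Matrix.mul_apply, Matrix.submatrix_apply, Finset.mul_sum, Finset.sum_mul]
    rw [Finset.sum_comm]
    simp only [mul_assoc]
  rw [Matrix.sub_apply, hE, Matrix.submatrix_apply, sub_nonneg]
  have hb := Finset.single_le_sum
    (f := fun j => A a.1 j * ∑ s : {x : Fin N // x ∈ S}, R j s.1 * Q s b)
    (fun j _ => mul_nonneg (hpos _ _) (hw j)) (Finset.mem_univ b.1)
  simp only [hS b, Matrix.one_apply_eq, mul_one] at hb
  exact hb

end
end

section
/- Row-sum bound on the error matrix. Let N be a positive integer, S ⊆ Fin N with complement S', and A an N×N real matrix that is symmetric, has nonnegative entries, and satisfies ‖A‖_∞ ≤ ρ for a fixed 0 < ρ < 1. Set R₀ := (I − A²)⁻¹, R₁ := A R₀, and E_S := [R₁]_S ([R₀]_S)⁻¹ − A_S. Then for every row index i ∈ S, the sum of the entries of the i-th row of E_S satisfies Σ_{j ∈ S} (E_S)_{ij} ≤ ρ. -/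
/-!
Row-sum bound on the error matrix: `Σ_{j ∈ S} (E_S)_{ij} ≤ ρ`.
-/

open scoped Classical

noncomputable section

/-- **Row-sum bound on the error matrix**: for a symmetric nonnegative matrix `A` with
maximum absolute row sum at most `ρ < 1`, setting `R₀ = (I − A²)⁻¹`, `R₁ = A R₀` and
`E_S = [R₁]_S ([R₀]_S)⁻¹ − A_S`, every row sum of `E_S` is at most `ρ`. -/
theorem error_matrix_row_sum_le
    (N : ℕ) (S : Finset (Fin N)) (ρ : ℝ) (hρ0 : 0 < ρ) (hρ1 : ρ < 1)
    (A : Matrix (Fin N) (Fin N) ℝ) (hsymm : A.IsSymm)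
    (hpos : ∀ u v, 0 ≤ A u v)
    (hnorm : ∀ u : Fin N, ∑ v, |A u v| ≤ ρ) :
    ∀ a : {x : Fin N // x ∈ S},
      ∑ b : {x : Fin N // x ∈ S},
        ((A * (1 - A ^ 2)⁻¹).submatrix
            (Subtype.val : {x : Fin N // x ∈ S} → Fin N)
            (Subtype.val : {x : Fin N // x ∈ S} → Fin N) *
          (((1 - A ^ 2)⁻¹).submatrix
            (Subtype.val : {x : Fin N // x ∈ S} → Fin N)
            (Subtype.val : {x : Fin N // x ∈ S} → Fin N))⁻¹ -
          A.submatrix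
            (Subtype.val : {x : Fin N // x ∈ S} → Fin N)
            (Subtype.val : {x : Fin N // x ∈ S} → Fin N)) a b ≤ ρ := by
  intro a
  have hA : ∀ (z : Fin N → ℝ) (m : ℝ), 0 ≤ m → (∀ i, z i ≤ m) → ∀ u, (A.mulVec z) u ≤ ρ * m := by
    intro z m hm hz u
    calc (A.mulVec z) u = ∑ v, A u v * z v := rfl
      _ ≤ ∑ v, |A u v| * m := by
        refine Finset.sum_le_sum fun v _ => ?_
        rw [abs_of_nonneg (hpos u v)]
        exact mul_le_mul_of_nonneg_left (hz v) (hpos u v)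
      _ = (∑ v, |A u v|) * m := by rw [Finset.sum_mul]
      _ ≤ ρ * m := mul_le_mul_of_nonneg_right (hnorm u) hm
  have hneg : ∑ b : {x : Fin N // x ∈ S}, (0 - A a.1 b.1) ≤ ρ := by
    refine le_trans (Finset.sum_nonpos fun b _ => ?_) hρ0.le
    have := hpos a.1 b.1
    linarith
  by_cases hM : IsUnit (1 - A ^ 2).det
  swap
  · rw [Matrix.nonsing_inv_apply_not_isUnit _ hM]
    simpa using hneg
  set R := (1 - A ^ 2)⁻¹ with hR
  set f : {x : Fin N // x ∈ S} → Fin N := Subtype.val with hf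
  by_cases hQ : IsUnit (R.submatrix f f).det
  swap
  · rw [Matrix.nonsing_inv_apply_not_isUnit _ hQ]
    simpa using hneg
  set y := ((R.submatrix f f)⁻¹).mulVec (fun _ => (1 : ℝ)) with hy
  set x := (R.submatrix id f).mulVec y with hx
  have hxS : ∀ b, x (f b) = 1 := by
    intro b
    have h1 : x (f b) = ((R.submatrix f f).mulVec y) b := rfl
    rw [h1, hy, Matrix.mulVec_mulVec, Matrix.mul_nonsing_inv _ hQ, Matrix.one_mulVec]
  have hxc : ∀ c, c ∉ S → x c = (A.mulVec (A.mulVec x)) c := by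
    intro c hc
    have h1 : (1 - A ^ 2).mulVec x = ((1 : Matrix (Fin N) (Fin N) ℝ).submatrix id f).mulVec y := by
      rw [hx, Matrix.mulVec_mulVec]
      congr 1
      have h0 : (1 - A ^ 2) * R = 1 := Matrix.mul_nonsing_inv _ hM
      have h4 : (1 - A ^ 2) * R.submatrix id f = ((1 - A ^ 2) * R).submatrix id f := rfl
      rw [h4, h0]
    have h2 := congrFun h1 c
    have h3 : (((1 : Matrix (Fin N) (Fin N) ℝ).submatrix id f).mulVec y) c = 0 := by
      refine Finset.sum_eq_zero fun b _ => ?_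
      have : c ≠ f b := fun h => hc (h ▸ b.2)
      simp [Matrix.one_apply, this]
    rw [h3, Matrix.sub_mulVec, Matrix.one_mulVec, pow_two, ← Matrix.mulVec_mulVec] at h2
    simp only [Pi.sub_apply] at h2
    linarith
  have hx1 : ∀ c, x c ≤ 1 := by
    haveI : Nonempty (Fin N) := ⟨a.1⟩
    obtain ⟨c, hc⟩ := Finite.exists_max x
    have : x c ≤ 1 := by
      by_contra hlt
      push Not at hlt
      have hcS : c ∉ S := fun h => by
        have := hxS ⟨c, h⟩
        simp only [hf] at this
        linarith
      have h1 := hA x (x c) (by linarith) hc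
      have h2 := hA _ _ (mul_nonneg hρ0.le (by linarith)) h1 c
      rw [← hxc c hcS] at h2
      have h3 : ρ * x c < x c := by nlinarith
      have h4 : ρ * (ρ * x c) ≤ ρ * x c := mul_le_mul_of_nonneg_left h3.le hρ0.le
      linarith
    exact fun d => (hc d).trans this
  have e1 : ∑ b, ((A * R).submatrix f f * (R.submatrix f f)⁻¹) a b = ∑ v, A a.1 v * x v := by
    have h1 : ∑ b, ((A * R).submatrix f f * (R.submatrix f f)⁻¹) a b
        = (((A * R).submatrix f f * (R.submatrix f f)⁻¹).mulVec (fun _ => (1 : ℝ))) a := by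
      simp [Matrix.mulVec, dotProduct]
    have h2 : (A * R).submatrix f f = A.submatrix f id * R.submatrix id f := rfl
    rw [h1, ← Matrix.mulVec_mulVec, ← hy, h2, ← Matrix.mulVec_mulVec, ← hx]
    rfl
  simp only [Matrix.sub_apply, Finset.sum_sub_distrib]
  rw [e1]
  have e2 : ∑ b, A.submatrix f f a b = ∑ v ∈ S, A a.1 v := by
    exact Finset.sum_coe_sort S (fun v => A a.1 v)
  have e3 : ∑ v ∈ S, A a.1 v = ∑ v ∈ S, A a.1 v * x v := by
    refine Finset.sum_congr rfl fun v hv => ?_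
    have := hxS ⟨v, hv⟩
    simp only [hf] at this
    rw [this, mul_one]
  rw [e2, e3, ← Finset.sum_add_sum_compl S, add_sub_cancel_left]
  calc ∑ v ∈ Sᶜ, A a.1 v * x v ≤ ∑ v ∈ Sᶜ, |A a.1 v| := by
        refine Finset.sum_le_sum fun v _ => ?_
        rw [abs_of_nonneg (hpos _ _)]
        exact mul_le_of_le_one_right (hpos _ _) (hx1 v)
    _ ≤ ∑ v, |A a.1 v| :=
        Finset.sum_le_sum_of_subset_of_nonneg (Finset.subset_univ _) fun _ _ _ => abs_nonneg _
    _ ≤ ρ := hnorm _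

end
end

section
/- Existence of the distance-threshold sequence r_N. Let (c_N) be a sequence of reals with c_N → ∞ and (log(log N + c_N))²/(log N) → 0 as N → ∞. Set ω_N := log(log N + c_N), p_N := (log N + c_N)/N, and r_N := ⌊(log N)/(2 ω_N)⌋. Then for every fixed ρ ∈ (0,1) and every fixed integer S ≥ 1, with p̃_N := S · p_N, both of the following limits hold as N → ∞: (a) N p_N ρ^{r_N + 4} → 0, and (b) p̃_N (N p̃_N)^{r_N + 2} → 0. (In particular, r_N → ∞.) -/
/-!
Existence of the distance-threshold sequence `r_N`.
-/

open Filter Real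

/-- **Existence of the distance-threshold sequence**: with `ω_N = log(log N + c_N)`,
`p_N = (log N + c_N)/N` and `r_N = ⌊log N / (2 ω_N)⌋`, if `c_N → ∞` and
`ω_N² / log N → 0`, then for every `ρ ∈ (0,1)` and integer `S ≥ 1` (with `p̃_N = S p_N`):
(a) `N p_N ρ^{r_N + 4} → 0`, (b) `p̃_N (N p̃_N)^{r_N + 2} → 0`, and `r_N → ∞`. -/
theorem distance_threshold_sequence_exists
    (c : ℕ → ℝ) (hc : Tendsto c atTop atTop)
    (hcond : Tendsto (fun N : ℕ =>
      (Real.log (Real.log N + c N)) ^ 2 / Real.log N) atTop (nhds 0))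
    (ρ : ℝ) (hρ0 : 0 < ρ) (hρ1 : ρ < 1) (S : ℕ) (hS : 1 ≤ S) :
    Tendsto (fun N : ℕ =>
        (N : ℝ) * ((Real.log N + c N) / N) *
          ρ ^ (⌊Real.log N / (2 * Real.log (Real.log N + c N))⌋ + 4))
      atTop (nhds 0) ∧
    Tendsto (fun N : ℕ =>
        ((S : ℝ) * ((Real.log N + c N) / N)) *
          ((N : ℝ) * ((S : ℝ) * ((Real.log N + c N) / N))) ^
            (⌊Real.log N / (2 * Real.log (Real.log N + c N))⌋ + 2))
      atTop (nhds 0) ∧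
    Tendsto (fun N : ℕ =>
        ⌊Real.log N / (2 * Real.log (Real.log N + c N))⌋)
      atTop atTop := by
  have hNR : Tendsto (fun N : ℕ => (N : ℝ)) atTop atTop := tendsto_natCast_atTop_atTop
  have hL : Tendsto (fun N : ℕ => Real.log (N : ℝ)) atTop atTop :=
    Real.tendsto_log_atTop.comp hNR
  have hX : Tendsto (fun N : ℕ => Real.log (N : ℝ) + c N) atTop atTop :=
    hL.atTop_add_atTop hc
  have hw : Tendsto (fun N : ℕ => Real.log (Real.log (N : ℝ) + c N)) atTop atTop :=
    Real.tendsto_log_atTop.comp hX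
  have key : ∀ K : ℝ, 0 < K → ∀ᶠ N : ℕ in atTop,
      K * (Real.log (Real.log (N : ℝ) + c N)) ^ 2 ≤ Real.log N := by
    intro K hK
    filter_upwards [hcond.eventually (gt_mem_nhds (inv_pos.mpr hK)),
      hL.eventually_gt_atTop 0] with N h1 h2
    rw [div_lt_iff₀ h2] at h1
    have := mul_lt_mul_of_pos_left h1 hK
    rw [← mul_assoc, mul_inv_cancel₀ hK.ne', one_mul] at this
    exact this.le
  have zp : ∀ (x : ℝ) (n : ℤ), 0 < x → x ^ n = Real.exp (Real.log x * n) := by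
    intro x n hx
    rw [← Real.rpow_intCast, Real.rpow_def_of_pos hx]
  refine ⟨?_, ?_, ?_⟩
  · have ha : 0 < -Real.log ρ := by
      have := Real.log_neg hρ0 hρ1
      linarith
    refine squeeze_zero' ?_ ?_ (Real.tendsto_exp_neg_atTop_nhds_zero.comp hw)
    · filter_upwards [hX.eventually_gt_atTop 0] with N h1
      positivity
    · filter_upwards [hX.eventually_gt_atTop 0, hNR.eventually_gt_atTop 0,
        hw.eventually_gt_atTop 1, key (4 / (-Real.log ρ)) (by positivity)] with N h1 h2 h3 h4
      rw [mul_div_cancel₀ _ h2.ne', zp ρ _ hρ0]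
      have hx : Real.log N + c N = Real.exp (Real.log (Real.log N + c N)) :=
        (Real.exp_log h1).symm
      simp only [Function.comp]
      generalize Real.log (Real.log N + c N) = w at *
      rw [hx, ← Real.exp_add]
      apply Real.exp_le_exp.mpr
      have hf := Int.lt_floor_add_one (Real.log N / (2 * w))
      generalize ⌊Real.log N / (2 * w)⌋ = r at *
      push_cast
      rw [div_mul_eq_mul_div, div_le_iff₀ ha] at h4
      rw [div_lt_iff₀ (by linarith)] at hf
      have h5 : 2 * w ≤ ((r : ℝ) + 1) * (-Real.log ρ) := by
        have h6 := mul_lt_mul_of_pos_right hf ha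
        have : w * (2 * w) ≤ w * (((r : ℝ) + 1) * (-Real.log ρ)) := by nlinarith
        exact le_of_mul_le_mul_left this (by linarith)
      nlinarith
  · have hS' : (1 : ℝ) ≤ S := by exact_mod_cast hS
    have hs : 0 ≤ Real.log S := Real.log_nonneg hS'
    have hlim : Tendsto (fun N : ℕ => Real.exp (-(Real.log N / 4))) atTop (nhds 0) :=
      Real.tendsto_exp_neg_atTop_nhds_zero.comp (hL.atTop_div_const (by norm_num))
    refine squeeze_zero' ?_ ?_ hlim
    · filter_upwards [hX.eventually_gt_atTop 0] with N h1
      positivity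
    · filter_upwards [hX.eventually_gt_atTop 0, hNR.eventually_gt_atTop 0,
        hw.eventually_gt_atTop (4 * Real.log S + 1), key 32 (by norm_num)] with N h1 h2 h3 h4
      have e1 : (N : ℝ) * ((S : ℝ) * ((Real.log N + c N) / N)) = S * (Real.log N + c N) := by
        field_simp
      have hSp : (0 : ℝ) < S := by linarith
      rw [e1, zp _ _ (by positivity), Real.log_mul hSp.ne' h1.ne']
      have hx : (S : ℝ) * ((Real.log N + c N) / N)
          = Real.exp (Real.log S + Real.log (Real.log N + c N) - Real.log N) := by
        rw [Real.exp_sub, Real.exp_add, Real.exp_log h1, Real.exp_log h2, Real.exp_log hSp]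
        ring
      rw [hx]
      generalize Real.log (Real.log N + c N) = w at *
      rw [← Real.exp_add]
      apply Real.exp_le_exp.mpr
      have hf := Int.floor_le (Real.log N / (2 * w))
      generalize ⌊Real.log N / (2 * w)⌋ = r at *
      push_cast
      have hw0 : 0 < w := by linarith
      rw [le_div_iff₀ (by linarith)] at hf
      generalize Real.log (N : ℝ) = L at *
      generalize Real.log (S : ℝ) = s at *
      have hL0 : 0 ≤ L := by nlinarith
      have h5 : (r : ℝ) * s ≤ L / 8 := by
        rcases le_or_gt (r : ℝ) 0 with h | h
        · nlinarith
        · nlinarith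
      have h6 : w ≤ w ^ 2 := by nlinarith
      nlinarith
  · refine tendsto_floor_atTop.comp ?_
    refine tendsto_atTop_mono' _ ?_ (hw.atTop_div_const (r := 2) (by norm_num))
    filter_upwards [hw.eventually_gt_atTop 0, key 1 one_pos] with N h1 h2
    rw [le_div_iff₀ (by linarith)]
    nlinarith
end
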